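/- The 2-skeleton of the k-dimensional cross polytope on Z_{2k} contains exactly (number of non-degenerate difference cycles avoiding difference k): the triangles of β^k are exactly the union of all difference cycles (a:b:c) with a+b+c = 2k and a,b,c ∉ {k}; counting gives 8·C(k,3) = sum over these difference cycles of their orbit sizes. -/

import Mathlib

/-- The difference cycle `(a : b : c)` on `ZMod n`, as a finset of triangles. -/
def diffCycleF (n a b : ℕ) [NeZero n] : Finset (Finset (ZMod n)) :=
  Finset.univ.image
    (fun i : ZMod n => ({i, i + (a : ZMod n), i + (a : ZMod n) + (b : ZMod n)} :
      Finset (ZMod n)))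

theorem aux_inj {n a b : ℕ} (ha : a < n) (hb : b < n)
    (h : (a : ZMod n) = (b : ZMod n)) : a = b := by
  rw [ZMod.natCast_eq_natCast_iff] at h
  exact Nat.ModEq.eq_of_lt_of_lt h ha hb

theorem aux_kk (k : ℕ) : (k : ZMod (2 * k)) + k = 0 := by
  have := ZMod.natCast_self (2 * k)
  push_cast at this
  linear_combination this

/-- Explicit description of the triangles of the cross polytope. -/
def auxTri (k : ℕ) [NeZero (2 * k)] : Finset (Finset (ZMod (2 * k))) :=
  (Finset.powersetCard 3 (Finset.univ : Finset (ZMod (2 * k)))).filter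
      (fun S => ∀ v ∈ S, v + (k : ZMod (2 * k)) ∉ S)

theorem aux_mem_tri {k a b c : ℕ} [NeZero (2 * k)] (ha : 0 < a) (hb : 0 < b) (hc : 0 < c)
    (hs : a + b + c = 2 * k) (hak : a ≠ k) (hbk : b ≠ k) (hck : c ≠ k) (i : ZMod (2 * k)) :
    ({i, i + (a : ZMod (2 * k)), i + (a : ZMod (2 * k)) + (b : ZMod (2 * k))} :
      Finset (ZMod (2 * k))) ∈ auxTri k := by
  have kk := aux_kk k
  have hk : 0 < k := by omega
  have a0 : (a : ZMod (2 * k)) ≠ 0 := fun h => by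
    have := aux_inj (n := 2 * k) (a := a) (b := 0) (by omega) (by omega) (by simpa using h)
    omega
  have b0 : (b : ZMod (2 * k)) ≠ 0 := fun h => by
    have := aux_inj (n := 2 * k) (a := b) (b := 0) (by omega) (by omega) (by simpa using h)
    omega
  have k0 : (k : ZMod (2 * k)) ≠ 0 := fun h => by
    have := aux_inj (n := 2 * k) (a := k) (b := 0) (by omega) (by omega) (by simpa using h)
    omega
  have ab0 : (a : ZMod (2 * k)) + b ≠ 0 := fun h => by
    have := aux_inj (n := 2 * k) (a := a + b) (b := 0) (by omega) (by omega) (by simpa using h)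
    omega
  have ak : (a : ZMod (2 * k)) ≠ k := fun h => hak (aux_inj (by omega) (by omega) h)
  have bk : (b : ZMod (2 * k)) ≠ k := fun h => hbk (aux_inj (by omega) (by omega) h)
  have abk : (a : ZMod (2 * k)) + b ≠ k := fun h => by
    have := aux_inj (n := 2 * k) (a := a + b) (b := k) (by omega) (by omega) (by simpa using h)
    omega
  unfold auxTri
  rw [Finset.mem_filter, Finset.mem_powersetCard]
  refine ⟨⟨Finset.subset_univ _, ?_⟩, ?_⟩
  · rw [Finset.card_eq_three]
    refine ⟨_, _, _, ?_, ?_, ?_, rfl⟩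
    · intro h; exact a0 (by linear_combination -h)
    · intro h; exact ab0 (by linear_combination -h)
    · intro h; exact b0 (by linear_combination -h)
  · intro v hv hv'
    simp only [Finset.mem_insert, Finset.mem_singleton] at hv hv'
    rcases hv with rfl | rfl | rfl <;> rcases hv' with h | h | h
    · exact k0 (by linear_combination h)
    · exact ak (by linear_combination -h)
    · exact abk (by linear_combination -h)
    · exact ak (by linear_combination h - kk)
    · exact k0 (by linear_combination h)
    · exact bk (by linear_combination -h)
    · exact abk (by linear_combination h - kk)
    · exact bk (by linear_combination h - kk)
    · exact k0 (by linear_combination h)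

theorem aux_sorted {k : ℕ} [NeZero (2 * k)] {S : Finset (ZMod (2 * k))}
    (hS : ∀ v ∈ S, v + (k : ZMod (2 * k)) ∉ S) (x y z : ZMod (2 * k))
    (hxyz : S = {x, y, z}) (h1 : x.val < y.val) (h2 : y.val < z.val) :
    ∃ a b c : ℕ, 0 < a ∧ 0 < b ∧ 0 < c ∧ a + b + c = 2 * k ∧ a ≠ k ∧ b ≠ k ∧ c ≠ k ∧
      S ∈ diffCycleF (2 * k) a b := by
  have hz := ZMod.val_lt z
  have key : ∀ u ∈ S, ∀ w ∈ S, w.val ≠ u.val + k := by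
    intro u hu w hw h
    apply hS u hu
    have : ((w.val : ℕ) : ZMod (2 * k)) = ((u.val + k : ℕ) : ZMod (2 * k)) := by rw [h]
    rw [Nat.cast_add, ZMod.natCast_zmod_val, ZMod.natCast_zmod_val] at this
    rwa [← this]
  have hx' : x ∈ S := by simp [hxyz]
  have hy' : y ∈ S := by simp [hxyz]
  have hz' : z ∈ S := by simp [hxyz]
  have k1 := key x hx' y hy'
  have k2 := key y hy' z hz'
  have k3 := key x hx' z hz'
  refine ⟨y.val - x.val, z.val - y.val, 2 * k - (z.val - x.val), by omega, by omega, by omega,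
    by omega, by omega, by omega, by omega, ?_⟩
  unfold diffCycleF
  rw [Finset.mem_image]
  refine ⟨x, Finset.mem_univ _, ?_⟩
  rw [Nat.cast_sub h1.le, Nat.cast_sub h2.le, ZMod.natCast_zmod_val, ZMod.natCast_zmod_val,
    ZMod.natCast_zmod_val, hxyz]
  have e1 : x + (y - x) = y := by ring
  have e2 : y + (z - y) = z := by ring
  rw [e1, e2]

theorem aux_exists {k : ℕ} [NeZero (2 * k)] {S : Finset (ZMod (2 * k))} (h : S ∈ auxTri k) :
    ∃ a b c : ℕ, 0 < a ∧ 0 < b ∧ 0 < c ∧ a + b + c = 2 * k ∧ a ≠ k ∧ b ≠ k ∧ c ≠ k ∧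
      S ∈ diffCycleF (2 * k) a b := by
  unfold auxTri at h
  rw [Finset.mem_filter, Finset.mem_powersetCard] at h
  obtain ⟨⟨-, h3⟩, hS⟩ := h
  obtain ⟨x, y, z, hxy, hxz, hyz, e⟩ := Finset.card_eq_three.1 h3
  have v1 : x.val ≠ y.val := fun h => hxy (ZMod.val_injective _ h)
  have v2 : x.val ≠ z.val := fun h => hxz (ZMod.val_injective _ h)
  have v3 : y.val ≠ z.val := fun h => hyz (ZMod.val_injective _ h)
  rcases lt_or_gt_of_ne v1 with h1 | h1 <;> rcases lt_or_gt_of_ne v2 with h2 | h2 <;>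
    rcases lt_or_gt_of_ne v3 with h3 | h3
  · exact aux_sorted hS x y z e h1 h3
  · exact aux_sorted hS x z y (by rw [e]; ext; simp; tauto) h2 h3
  · omega
  · exact aux_sorted hS z x y (by rw [e]; ext; simp; tauto) h2 h1
  · exact aux_sorted hS y x z (by rw [e]; ext; simp; tauto) h1 h2
  · omega
  · exact aux_sorted hS y z x (by rw [e]; ext; simp; tauto) h3 h2
  · exact aux_sorted hS z y x (by rw [e]; ext; simp; tauto) h3 h1

/-- A difference cycle is the translation orbit of any of its members. -/
theorem aux_orbit {n a b : ℕ} [NeZero n] {S : Finset (ZMod n)} (h : S ∈ diffCycleF n a b) :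
    diffCycleF n a b = Finset.univ.image (fun t : ZMod n => S.image (fun s => t + s)) := by
  unfold diffCycleF at *
  rw [Finset.mem_image] at h
  obtain ⟨i, -, rfl⟩ := h
  ext T
  simp only [Finset.mem_image, Finset.mem_univ, true_and, Finset.image_insert,
    Finset.image_singleton]
  constructor
  · rintro ⟨j, rfl⟩
    refine ⟨j - i, ?_⟩
    congr 1
    · ring
    · congr 1
      · ring
      · congr 1; ring
  · rintro ⟨t, rfl⟩
    refine ⟨t + i, ?_⟩
    simp only [add_assoc]

/-- Lift of a vertex class `x < k` to one of its two representatives. -/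
def auxLift (k : ℕ) (U : Finset ℕ) (x : ℕ) : ℕ := if x ∈ U then x else x + k

theorem aux_card (k : ℕ) [NeZero (2 * k)] : (auxTri k).card = 8 * Nat.choose k 3 := by
  have hk : 0 < k := by have := NeZero.ne (2 * k); omega
  have kk := aux_kk k
  have hlift : ∀ U x, x < k → auxLift k U x < 2 * k ∧ auxLift k U x % k = x := by
    intro U x hx
    unfold auxLift
    split_ifs
    · exact ⟨by omega, Nat.mod_eq_of_lt hx⟩
    · exact ⟨by omega, by rw [Nat.add_mod_right, Nat.mod_eq_of_lt hx]⟩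
  let A : Finset (Σ _ : Finset ℕ, Finset ℕ) :=
    (Finset.powersetCard 3 (Finset.range k)).sigma (fun T => T.powerset)
  have hA : A.card = 8 * Nat.choose k 3 := by
    rw [Finset.card_sigma, Finset.sum_congr rfl (g := fun _ => 8)]
    · simp [Finset.card_powersetCard, mul_comm]
    · intro T hT
      rw [Finset.card_powerset, (Finset.mem_powersetCard.1 hT).2]
      norm_num
  let f : (Σ _ : Finset ℕ, Finset ℕ) → Finset (ZMod (2 * k)) := fun p =>
    p.1.image (fun x => ((auxLift k p.2 x : ℕ) : ZMod (2 * k)))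
  have hmem : ∀ T U : Finset ℕ, T ⊆ Finset.range k → ∀ y < 2 * k,
      ((y : ℕ) : ZMod (2 * k)) ∈ f ⟨T, U⟩ ↔ (y % k ∈ T ∧ y = auxLift k U (y % k)) := by
    intro T U hT y hy
    simp only [f, Finset.mem_image]
    constructor
    · rintro ⟨x, hx, h⟩
      have hxk := Finset.mem_range.1 (hT hx)
      have := aux_inj (hlift U x hxk).1 hy h
      rw [← this, (hlift U x hxk).2]
      exact ⟨hx, rfl⟩
    · rintro ⟨h1, h2⟩
      exact ⟨_, h1, by rw [← h2]⟩
  rw [← hA]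
  symm
  apply Finset.card_bij (fun p _ => f p)
  · rintro ⟨T, U⟩ hp
    simp only [A, Finset.mem_sigma, Finset.mem_powersetCard, Finset.mem_powerset] at hp
    obtain ⟨⟨hT, hc⟩, hU⟩ := hp
    unfold auxTri
    rw [Finset.mem_filter, Finset.mem_powersetCard]
    refine ⟨⟨Finset.subset_univ _, ?_⟩, ?_⟩
    · rw [← hc]
      apply Finset.card_image_of_injOn
      intro x hx y hy h
      have hx := hlift U x (Finset.mem_range.1 (hT hx))
      have hy := hlift U y (Finset.mem_range.1 (hT hy))
      have := aux_inj hx.1 hy.1 h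
      rw [← hx.2, ← hy.2, this]
    · intro v hv hv'
      obtain ⟨x, hx, rfl⟩ := Finset.mem_image.1 hv
      obtain ⟨y, hy, h⟩ := Finset.mem_image.1 hv'
      have hxk := Finset.mem_range.1 (hT hx)
      have hyk := Finset.mem_range.1 (hT hy)
      have lx := hlift U x hxk
      have ly := hlift U y hyk
      simp only at h
      rcases lt_or_ge (auxLift k U x) k with hl | hl
      · have := aux_inj (n := 2 * k) (a := auxLift k U y) (b := auxLift k U x + k) ly.1 (by omega)
          (by push_cast; exact h)
        have e : y = x := by rw [← ly.2, this, Nat.add_mod_right, lx.2]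
        subst e; omega
      · have := aux_inj (n := 2 * k) (a := auxLift k U y) (b := auxLift k U x - k) ly.1 (by omega)
          (by rw [Nat.cast_sub hl]; linear_combination h + kk)
        have e : y = x := by
          rw [← ly.2, ← lx.2, this]
          conv_rhs => rw [← Nat.sub_add_cancel hl, Nat.add_mod_right]
        subst e; omega
  · rintro ⟨T, U⟩ hp ⟨T', U'⟩ hp' h
    simp only [A, Finset.mem_sigma, Finset.mem_powersetCard, Finset.mem_powerset] at hp hp'
    obtain ⟨⟨hT, hc⟩, hU⟩ := hp
    obtain ⟨⟨hT', hc'⟩, hU'⟩ := hp'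
    have h : f ⟨T, U⟩ = f ⟨T', U'⟩ := h
    have hTT : ∀ T U : Finset ℕ, T ⊆ Finset.range k →
        T = (f ⟨T, U⟩).image (fun v => v.val % k) := by
      intro T U hT
      simp only [f, Finset.image_image]
      ext x
      simp only [Finset.mem_image, Function.comp]
      have : ∀ y ∈ T, ((auxLift k U y : ℕ) : ZMod (2 * k)).val % k = y := by
        intro y hy
        have ly := hlift U y (Finset.mem_range.1 (hT hy))
        rw [ZMod.val_natCast_of_lt ly.1, ly.2]
      constructor
      · intro hx; exact ⟨x, hx, this x hx⟩
      · rintro ⟨y, hy, rfl⟩; rw [this y hy]; exact hy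
    have hUU : ∀ T U : Finset ℕ, T ⊆ Finset.range k → U ⊆ T →
        ∀ x, x ∈ U ↔ x < k ∧ ((x : ℕ) : ZMod (2 * k)) ∈ f ⟨T, U⟩ := by
      intro T U hT hU x
      constructor
      · intro hx
        have hxk := Finset.mem_range.1 (hT (hU hx))
        refine ⟨hxk, (hmem T U hT x (by omega)).2 ?_⟩
        rw [Nat.mod_eq_of_lt hxk]
        exact ⟨hU hx, by simp [auxLift, hx]⟩
      · rintro ⟨hxk, hx⟩
        have := ((hmem T U hT x (by omega)).1 hx).2
        rw [Nat.mod_eq_of_lt hxk] at this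
        by_contra hn
        simp only [auxLift, hn, if_false] at this
        omega
    have e1 : T = T' := by rw [hTT T U hT, hTT T' U' hT', h]
    have e2 : U = U' := by
      ext x
      rw [hUU T U hT hU, hUU T' U' hT' hU', h]
    rw [e1, e2]
  · intro S hS
    unfold auxTri at hS
    rw [Finset.mem_filter, Finset.mem_powersetCard] at hS
    obtain ⟨⟨-, h3⟩, hS⟩ := hS
    have hinj : ∀ v ∈ S, ∀ w ∈ S, v.val % k = w.val % k → v.val < k → ¬ w.val < k → False := by
      intro v hv w hw h hvk hwk
      have hw2 := ZMod.val_lt w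
      rw [Nat.mod_eq_of_lt hvk, Nat.mod_eq_sub_mod (by omega), Nat.mod_eq_of_lt (by omega)] at h
      apply hS v hv
      have : w.val = v.val + k := by omega
      have : ((w.val : ℕ) : ZMod (2 * k)) = ((v.val + k : ℕ) : ZMod (2 * k)) := by rw [this]
      rw [Nat.cast_add, ZMod.natCast_zmod_val, ZMod.natCast_zmod_val] at this
      rwa [← this]
    have hlt : ∀ v : ZMod (2 * k), ¬ v.val < k → v.val % k = v.val - k := by
      intro v hv
      have := ZMod.val_lt v
      rw [Nat.mod_eq_sub_mod (by omega), Nat.mod_eq_of_lt (by omega)]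
    let T := S.image (fun v => v.val % k)
    let U := (S.filter (fun v => v.val < k)).image (fun v => v.val % k)
    have hval : ∀ v ∈ S, auxLift k U (v.val % k) = v.val := by
      intro v hv
      unfold auxLift
      split_ifs with hu
      · obtain ⟨w, hw, e⟩ := Finset.mem_image.1 hu
        rw [Finset.mem_filter] at hw
        by_cases hvk : v.val < k
        · exact Nat.mod_eq_of_lt hvk
        · exact (hinj w hw.1 v hv e hw.2 hvk).elim
      · by_cases hvk : v.val < k
        · exact (hu (Finset.mem_image.2 ⟨v, Finset.mem_filter.2 ⟨hv, hvk⟩, rfl⟩)).elim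
        · rw [hlt v hvk]; omega
    refine ⟨⟨T, U⟩, ?_, ?_⟩
    · simp only [A, Finset.mem_sigma, Finset.mem_powersetCard, Finset.mem_powerset]
      refine ⟨⟨?_, ?_⟩, ?_⟩
      · intro x hx
        obtain ⟨v, hv, rfl⟩ := Finset.mem_image.1 hx
        exact Finset.mem_range.2 (Nat.mod_lt _ hk)
      · rw [← h3]
        apply Finset.card_image_of_injOn
        intro v hv w hw h
        apply ZMod.val_injective
        rw [← hval v hv, ← hval w hw]
        exact congrArg _ h
      · exact Finset.image_subset_image (Finset.filter_subset _ _)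
    · simp only [f, T, Finset.image_image]
      conv_rhs => rw [← Finset.image_id (s := S)]
      apply Finset.image_congr
      intro v hv
      simp only [Function.comp, id]
      rw [hval v hv, ZMod.natCast_zmod_val]

/-- The triangles of the cross polytope `β^k` (3-subsets of `ZMod (2k)` with no antipodal
pair `{v, v+k}`) are exactly the union of all difference cycles `(a:b:c)` with
`a + b + c = 2k` and `a, b, c ≠ k`; counting gives `8·C(k,3)` as the sum of the orbit
sizes of these difference cycles. -/
theorem crossPolytope_triangles_eq_union_diffCycles (k : ℕ) [NeZero (2 * k)] :
    let triples := ((Finset.range (2 * k + 1)) ×ˢ (Finset.range (2 * k + 1)) ×ˢ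
        (Finset.range (2 * k + 1))).filter
      (fun p => 0 < p.1 ∧ 0 < p.2.1 ∧ 0 < p.2.2 ∧ p.1 + p.2.1 + p.2.2 = 2 * k ∧
        p.1 ≠ k ∧ p.2.1 ≠ k ∧ p.2.2 ≠ k)
    ((Finset.powersetCard 3 (Finset.univ : Finset (ZMod (2 * k)))).filter
      (fun S => ∀ v ∈ S, v + (k : ZMod (2 * k)) ∉ S))
      = triples.sup (fun p => diffCycleF (2 * k) p.1 p.2.1) ∧
    8 * Nat.choose k 3
      = ∑ D ∈ triples.image (fun p => diffCycleF (2 * k) p.1 p.2.1), D.card := by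
  intro triples
  have hset : auxTri k = triples.sup (fun p => diffCycleF (2 * k) p.1 p.2.1) := by
    ext S
    rw [Finset.mem_sup]
    constructor
    · intro h
      obtain ⟨a, b, c, ha, hb, hc, hs, h1, h2, h3, hS⟩ := aux_exists h
      refine ⟨(a, b, c), ?_, hS⟩
      simp only [triples, Finset.mem_filter, Finset.mem_product, Finset.mem_range]
      exact ⟨⟨by omega, by omega, by omega⟩, ha, hb, hc, hs, h1, h2, h3⟩
    · rintro ⟨⟨a, b, c⟩, hp, hS⟩
      simp only [triples, Finset.mem_filter, Finset.mem_product, Finset.mem_range] at hp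
      obtain ⟨-, ha, hb, hc, hs, h1, h2, h3⟩ := hp
      obtain ⟨i, -, rfl⟩ := Finset.mem_image.1 hS
      exact aux_mem_tri ha hb hc hs h1 h2 h3 i
  refine ⟨hset, ?_⟩
  rw [← aux_card k, hset, Finset.sup_eq_biUnion]
  have hb : triples.biUnion (fun p => diffCycleF (2 * k) p.1 p.2.1)
      = (triples.image (fun p => diffCycleF (2 * k) p.1 p.2.1)).biUnion id := by
    rw [Finset.image_biUnion]; rfl
  rw [hb, Finset.card_biUnion]
  · rfl
  · intro D hD E hE hne
    obtain ⟨p, -, rfl⟩ := Finset.mem_image.1 hD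
    obtain ⟨q, -, rfl⟩ := Finset.mem_image.1 hE
    refine Finset.disjoint_left.2 ?_
    intro S h1 h2
    exact hne ((aux_orbit h1).trans (aux_orbit h2).symm)
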